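/- Let H be a Hopf algebra of finite dimension d over a field k, let {h_i} be a basis of H with dual basis {h_i*} of H* = Hom_k(H, k), and equip H* with the convolution product (f * g)(x) = Σ f(x_{(1)}) g(x_{(2)}) and unit ε, making it an associative unital k-algebra. Let V₊ be a finite-dimensional H-module and V₋ a finite-dimensional H*-module, and let T : V₊ ⊗ V₋ → V₊ ⊗ V₋ be the linear endomorphism T(v ⊗ w) = Σ_i (h_i · v) ⊗ (h_i* · w). Then det(T)^d = 1. -/

import Mathlib

open TensorProduct

noncomputable section


namespace DualConv

variable {k H : Type*} [CommSemiring k] [AddCommMonoid H] [Module k H] [Coalgebra k H]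

/-- The convolution product on the linear dual of a coalgebra:
`(f * g)(x) = ∑ f(x⁽¹⁾) g(x⁽²⁾)`. -/
def convDual (f g : H →ₗ[k] k) : H →ₗ[k] k :=
  LinearMap.mul' k k ∘ₗ TensorProduct.map f g ∘ₗ Coalgebra.comul

lemma convDual_apply {ι : Type*} (f g : H →ₗ[k] k) (x : H) (r : Coalgebra.Repr k x ι) :
    convDual f g x = ∑ i ∈ r.index, f (r.left i) * g (r.right i) := by
  simp [convDual, ← r.eq, map_sum]

lemma convDual_assoc (f g h : H →ₗ[k] k) :
    convDual (convDual f g) h = convDual f (convDual g h) := by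
  apply LinearMap.ext; intro x
  set r := Coalgebra.Repr.arbitrary k x with hr
  set a₁ : (i : r.ι) → Coalgebra.Repr k (r.left i) (H × H) := fun i => Coalgebra.Repr.arbitrary k _
  set a₂ : (i : r.ι) → Coalgebra.Repr k (r.right i) (H × H) := fun i => Coalgebra.Repr.arbitrary k _
  have key := Coalgebra.sum_map_tmul_tmul_eq (R := k) f g h x (repr := r) (a₁ := a₁) (a₂ := a₂)
  have := congrArg (LinearMap.mul' k k ∘ₗ (LinearMap.mul' k k).lTensor k) key
  simp only [map_sum, LinearMap.comp_apply, LinearMap.lTensor_tmul, LinearMap.mul'_apply] at this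
  calc convDual (convDual f g) h x
      = ∑ i ∈ r.index, convDual f g (r.left i) * h (r.right i) := convDual_apply _ _ _ r
    _ = ∑ i ∈ r.index, (∑ j ∈ (a₁ i).index, f ((a₁ i).left j) * g ((a₁ i).right j)) * h (r.right i) := by
        refine Finset.sum_congr rfl fun i _ => ?_
        rw [convDual_apply _ _ _ (a₁ i)]
    _ = ∑ i ∈ r.index, ∑ j ∈ (a₁ i).index, f ((a₁ i).left j) * (g ((a₁ i).right j) * h (r.right i)) := by
        refine Finset.sum_congr rfl fun i _ => ?_
        rw [Finset.sum_mul]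
        exact Finset.sum_congr rfl fun j _ => mul_assoc _ _ _
    _ = ∑ i ∈ r.index, ∑ j ∈ (a₂ i).index, f (r.left i) * (g ((a₂ i).left j) * h ((a₂ i).right j)) := this.symm
    _ = ∑ i ∈ r.index, f (r.left i) * convDual g h (r.right i) := by
        refine Finset.sum_congr rfl fun i _ => ?_
        rw [convDual_apply _ _ _ (a₂ i), Finset.mul_sum]
    _ = convDual f (convDual g h) x := (convDual_apply _ _ _ r).symm

lemma convDual_one (f : H →ₗ[k] k) : convDual (Coalgebra.counit) f = f := by
  apply LinearMap.ext; intro x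
  have key := Coalgebra.sum_counit_tmul_map_eq (R := k) f x (repr := Coalgebra.Repr.arbitrary k x)
  have := congrArg (LinearMap.mul' k k) key
  simp only [map_sum, LinearMap.mul'_apply, one_mul] at this
  rw [convDual_apply _ _ _ (Coalgebra.Repr.arbitrary k x)]
  exact this

lemma one_convDual (f : H →ₗ[k] k) : convDual f (Coalgebra.counit) = f := by
  apply LinearMap.ext; intro x
  have key := Coalgebra.sum_map_tmul_counit_eq (R := k) f x (repr := Coalgebra.Repr.arbitrary k x)
  have := congrArg (LinearMap.mul' k k) key
  simp only [map_sum, LinearMap.mul'_apply, mul_one] at this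
  rw [convDual_apply _ _ _ (Coalgebra.Repr.arbitrary k x)]
  exact this

lemma convDual_add (f g h : H →ₗ[k] k) : convDual f (g + h) = convDual f g + convDual f h := by
  simp [convDual, TensorProduct.map_add_right, LinearMap.comp_add, LinearMap.add_comp]

lemma add_convDual (f g h : H →ₗ[k] k) : convDual (f + g) h = convDual f h + convDual g h := by
  simp [convDual, TensorProduct.map_add_left, LinearMap.comp_add, LinearMap.add_comp]

lemma convDual_zero (f : H →ₗ[k] k) : convDual f 0 = 0 := by
  simp [convDual]

lemma zero_convDual (f : H →ₗ[k] k) : convDual 0 f = 0 := by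
  simp [convDual]

end DualConv

/-- The convolution (semi)ring structure on the linear dual of a coalgebra, with product
`(f * g)(x) = ∑ f(x⁽¹⁾) g(x⁽²⁾)` and unit the counit `ε`. -/
noncomputable instance dualConvSemiring (k H : Type*) [CommSemiring k] [AddCommMonoid H]
    [Module k H] [Coalgebra k H] : Semiring (H →ₗ[k] k) :=
  { (inferInstance : AddCommMonoid (H →ₗ[k] k)) with
    mul := DualConv.convDual
    one := Coalgebra.counit
    mul_assoc := DualConv.convDual_assoc
    one_mul := DualConv.convDual_one
    mul_one := DualConv.one_convDual
    left_distrib := DualConv.convDual_add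
    right_distrib := fun f g h => DualConv.add_convDual f g h
    mul_zero := DualConv.convDual_zero
    zero_mul := DualConv.zero_convDual }

noncomputable instance dualConvRing (k H : Type*) [CommRing k] [AddCommGroup H]
    [Module k H] [Coalgebra k H] : Ring (H →ₗ[k] k) :=
  { dualConvSemiring k H, (inferInstance : AddCommGroup (H →ₗ[k] k)) with }


namespace DetAux

variable {k H : Type*} [Field k] [Ring H] [HopfAlgebra k H]

def conv {A : Type*} [Ring A] [Algebra k A] (ρ σ : H →ₗ[k] A) : H →ₗ[k] A :=
  LinearMap.mul' k A ∘ₗ TensorProduct.map ρ σ ∘ₗ Coalgebra.comul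

def eps (A : Type*) [Ring A] [Algebra k A] : H →ₗ[k] A :=
  Algebra.linearMap k A ∘ₗ Coalgebra.counit

lemma conv_antipode_left {A : Type*} [Ring A] [Algebra k A] (ρ : H →ₐ[k] A) :
    conv (ρ.toLinearMap ∘ₗ HopfAlgebra.antipode k) ρ.toLinearMap = eps A := by
  have h := HopfAlgebra.mul_antipode_rTensor_comul (R := k) (A := H)
  have h2 := congrArg (fun f => ρ.toLinearMap ∘ₗ f) h
  refine Eq.trans ?_ (h2.trans ?_)
  · unfold conv
    ext x
    simp only [LinearMap.comp_apply]
    induction (Coalgebra.comul (R := k) x : H ⊗[k] H) with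
    | zero => simp
    | tmul a c => simp
    | add a c ha hc => simp only [map_add, ha, hc]
  · ext x
    simp [eps]

lemma conv_antipode_right {A : Type*} [Ring A] [Algebra k A] (ρ : H →ₐ[k] A) :
    conv ρ.toLinearMap (ρ.toLinearMap ∘ₗ HopfAlgebra.antipode k) = eps A := by
  have h := HopfAlgebra.mul_antipode_lTensor_comul (R := k) (A := H)
  have h2 := congrArg (fun f => ρ.toLinearMap ∘ₗ f) h
  refine Eq.trans ?_ (h2.trans ?_)
  · unfold conv
    ext x
    simp only [LinearMap.comp_apply]
    induction (Coalgebra.comul (R := k) x : H ⊗[k] H) with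
    | zero => simp
    | tmul a c => simp
    | add a c ha hc => simp only [map_add, ha, hc]
  · ext x
    simp [eps]

section T
variable {ι : Type*} [Fintype ι] [DecidableEq ι] (b : Module.Basis ι k H)
variable {W : Type*} [AddCommGroup W] [Module k W] (F : (H →ₗ[k] k) →ₗ[k] Module.End k W)
variable {X : Type*} [AddCommGroup X] [Module k X]

def T (ρ : H →ₗ[k] Module.End k X) : Module.End k (X ⊗[k] W) :=
  ∑ i, TensorProduct.map (ρ (b i)) (F (b.coord i))

lemma expand_conv {A : Type*} [Ring A] [Algebra k A] (ρ σ : H →ₗ[k] A) (x : H) :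
    conv ρ σ x = ∑ i, ∑ j, (DualConv.convDual (b.coord i) (b.coord j) x) • (ρ (b i) * σ (b j)) := by
  unfold conv DualConv.convDual
  simp only [LinearMap.comp_apply]
  induction (Coalgebra.comul (R := k) x : H ⊗[k] H) with
  | zero => simp
  | tmul a c =>
    have e1 : ρ a = ∑ i, b.repr a i • ρ (b i) := by
      conv_lhs => rw [← b.sum_repr a]
      simp only [map_sum, map_smul]
    have e2 : σ c = ∑ i, b.repr c i • σ (b i) := by
      conv_lhs => rw [← b.sum_repr c]
      simp only [map_sum, map_smul]
    simp only [TensorProduct.map_tmul, LinearMap.mul'_apply, Module.Basis.coord_apply]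
    rw [e1, e2, Finset.sum_mul_sum]
    simp only [smul_mul_smul_comm]
  | add a c ha hc => simp only [map_add, ha, hc, add_smul, Finset.sum_add_distrib]

lemma expand_dual (f : H →ₗ[k] k) : f = ∑ l, f (b l) • b.coord l := by
  apply b.ext; intro j
  simp [Finsupp.single_apply]

lemma T_conv (hF : ∀ f g, F (DualConv.convDual f g) = F f * F g)
    (ρ σ : H →ₗ[k] Module.End k X) : T b F (conv ρ σ) = T b F ρ * T b F σ := by
  unfold T
  rw [Finset.sum_mul_sum]
  simp only [← TensorProduct.map_mul, ← hF]
  have : ∀ i j, F (DualConv.convDual (b.coord i) (b.coord j)) =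
      ∑ l, (DualConv.convDual (b.coord i) (b.coord j) (b l)) • F (b.coord l) := by
    intro i j
    conv_lhs => rw [expand_dual b (DualConv.convDual (b.coord i) (b.coord j))]
    simp only [map_sum, map_smul]
  simp only [this, expand_conv b]
  have e : ∀ (P : Module.End k X) (Q : Module.End k W),
    TensorProduct.map P Q = TensorProduct.mapBilinear (RingHom.id k) X W X W P Q := fun _ _ => rfl
  simp only [e, map_sum, LinearMap.sum_apply, map_smul, LinearMap.smul_apply]
  rw [Finset.sum_comm]
  refine Finset.sum_congr rfl fun i _ => ?_
  rw [Finset.sum_comm]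

lemma T_eps (h1 : F Coalgebra.counit = 1) : T b F (eps (Module.End k X)) = 1 := by
  unfold T eps
  have h2 := h1
  rw [expand_dual b Coalgebra.counit] at h2
  simp only [map_sum, map_smul] at h2
  have e : ∀ (P : Module.End k X) (Q : Module.End k W),
    TensorProduct.map P Q = TensorProduct.mapBilinear (RingHom.id k) X W X W P Q := fun _ _ => rfl
  simp only [e, LinearMap.comp_apply, Algebra.linearMap_apply, Algebra.algebraMap_eq_smul_one,
    map_smul, LinearMap.smul_apply]
  rw [← TensorProduct.map_one, e, ← h2]
  simp only [map_sum, map_smul]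

end T

section Phi
variable {V : Type*} [AddCommGroup V] [Module k V]

def Phi (θ : H →ₗ[k] Module.End k V) : Module.End k (H ⊗[k] V) :=
  (TensorProduct.lift θ).lTensor H ∘ₗ (TensorProduct.assoc k H H V).toLinearMap ∘ₗ
    (Coalgebra.comul (R := k) (A := H)).rTensor V

lemma Phi_conv (θ σ : H →ₗ[k] Module.End k V) : Phi (conv θ σ) = Phi θ * Phi σ := by
  ext x v
  have h := Coalgebra.coassoc_apply (R := k) x
  let Q : H ⊗[k] (H ⊗[k] H) →ₗ[k] H ⊗[k] V :=
    (LinearMap.applyₗ v ∘ₗ LinearMap.mul' k (Module.End k V) ∘ₗ TensorProduct.map θ σ).lTensor H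
  have hQ := congrArg Q h
  refine Eq.trans ?_ (hQ.symm.trans ?_)
  · simp only [Phi, Q, TensorProduct.AlgebraTensorModule.curry_apply, LinearMap.restrictScalars_self,
      TensorProduct.curry_apply, LinearMap.comp_apply, LinearMap.rTensor_tmul]
    induction (Coalgebra.comul (R := k) x : H ⊗[k] H) with
    | zero => simp
    | tmul a c => simp [conv]
    | add a c ha hc => simp only [map_add, ha, hc, TensorProduct.add_tmul]
  · simp only [Phi, Q, TensorProduct.AlgebraTensorModule.curry_apply, LinearMap.restrictScalars_self,
      TensorProduct.curry_apply, LinearMap.comp_apply, LinearMap.rTensor_tmul, Module.End.mul_apply]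
    induction (Coalgebra.comul (R := k) x : H ⊗[k] H) with
    | zero => simp
    | tmul a c =>
      simp only [LinearMap.rTensor_tmul, LinearEquiv.coe_coe, TensorProduct.assoc_tmul,
        LinearMap.lTensor_tmul, TensorProduct.lift.tmul]
      induction (Coalgebra.comul (R := k) a : H ⊗[k] H) with
      | zero => simp
      | tmul p q => simp
      | add p q hp hq => simp only [map_add, hp, hq, TensorProduct.add_tmul]
    | add a c ha hc => simp only [map_add, ha, hc, TensorProduct.add_tmul]

lemma Phi_eps : Phi (eps (k := k) (H := H) (Module.End k V)) = 1 := by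
  ext x v
  have h := Coalgebra.lTensor_counit_comul (R := k) x
  have h2 := congrArg (((LinearMap.toSpanSingleton k V v)).lTensor H) h
  refine Eq.trans ?_ (h2.trans (by simp))
  simp only [Phi, TensorProduct.AlgebraTensorModule.curry_apply, LinearMap.restrictScalars_self,
      TensorProduct.curry_apply, LinearMap.comp_apply, LinearMap.rTensor_tmul]
  induction (Coalgebra.comul (R := k) x : H ⊗[k] H) with
  | zero => simp
  | tmul a c => simp [eps]
  | add a c ha hc => simp only [map_add, ha, hc, TensorProduct.add_tmul]

def rho1 (V : Type*) [AddCommGroup V] [Module k V] : H →ₐ[k] Module.End k (H ⊗[k] V) :=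
  AlgHom.ofLinearMap (LinearMap.rTensorHom V ∘ₗ LinearMap.mul k H)
    (by ext; simp) (fun x y => by ext; simp [mul_assoc])

def rho2 (θ : H →ₗ[k] Module.End k V) : H →ₗ[k] Module.End k (H ⊗[k] V) :=
  LinearMap.lTensorHom H ∘ₗ θ

lemma Phi_rho (θ : H →ₐ[k] Module.End k V) (h : H) :
    Phi θ.toLinearMap * (rho1 V h) =
      conv (rho1 V).toLinearMap (rho2 θ.toLinearMap) h * Phi θ.toLinearMap := by
  ext x v
  simp only [Phi, conv, TensorProduct.AlgebraTensorModule.curry_apply, LinearMap.restrictScalars_self,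
      TensorProduct.curry_apply, LinearMap.comp_apply, LinearMap.rTensor_tmul, Module.End.mul_apply]
  have : rho1 V h (x ⊗ₜ[k] v) = (h * x) ⊗ₜ[k] v := by simp [rho1]
  rw [this]
  simp only [LinearMap.rTensor_tmul, Bialgebra.comul_mul]
  induction (Coalgebra.comul (R := k) x : H ⊗[k] H) with
  | zero => simp
  | add a c ha hc => simp only [mul_add, map_add, ha, hc, TensorProduct.add_tmul]
  | tmul a c =>
    induction (Coalgebra.comul (R := k) h : H ⊗[k] H) with
    | zero => simp
    | add a c ha hc => simp only [add_mul, map_add, ha, hc, TensorProduct.add_tmul, LinearMap.add_apply]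
    | tmul p q => simp [rho1, rho2]

end Phi

lemma det_lT {X Y : Type*} [AddCommGroup X] [Module k X] [AddCommGroup Y] [Module k Y]
    [FiniteDimensional k X] [FiniteDimensional k Y] (f : Module.End k Y) :
    LinearMap.det (f.lTensor X) = LinearMap.det f ^ Module.finrank k X := by
  classical
  let bX := Module.finBasis k X
  let bY := Module.finBasis k Y
  rw [← LinearMap.det_toMatrix (bX.tensorProduct bY), LinearMap.lTensor,
    TensorProduct.toMatrix_map, Matrix.det_kronecker]
  simp

lemma main {ι : Type*} [Fintype ι] [DecidableEq ι] (b : Module.Basis ι k H)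
    {W : Type*} [AddCommGroup W] [Module k W] (F : (H →ₗ[k] k) →ₗ[k] Module.End k W)
    (hF : ∀ f g, F (DualConv.convDual f g) = F f * F g) (h1 : F Coalgebra.counit = 1)
    {V : Type*} [AddCommGroup V] [Module k V] (θ : H →ₐ[k] Module.End k V)
    [FiniteDimensional k H] [FiniteDimensional k V] [FiniteDimensional k W] :
    LinearMap.det (T b F θ.toLinearMap) ^ Module.finrank k H = 1 := by
  have i1 : T b F ((rho1 V).toLinearMap ∘ₗ HopfAlgebra.antipode k) *
      T b F (rho1 V).toLinearMap = 1 := by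
    rw [← T_conv b F hF, conv_antipode_left, T_eps b F h1]
  have i2 : Phi (θ.toLinearMap ∘ₗ HopfAlgebra.antipode k) * Phi θ.toLinearMap = 1 := by
    rw [← Phi_conv, conv_antipode_left, Phi_eps]
  have i3 : (Phi θ.toLinearMap).rTensor W * T b F (rho1 V).toLinearMap =
      (T b F (rho1 V).toLinearMap * T b F (rho2 θ.toLinearMap)) *
        (Phi θ.toLinearMap).rTensor W := by
    rw [← T_conv b F hF]
    unfold T
    rw [Finset.sum_mul, Finset.mul_sum]
    refine Finset.sum_congr rfl fun i _ => ?_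
    have := Phi_rho θ (b i)
    simp only [LinearMap.rTensor, ← Module.End.one_eq_id, ← TensorProduct.map_mul, mul_one, one_mul]
    rw [← this]; rfl
  have i4 : (Phi (θ.toLinearMap ∘ₗ HopfAlgebra.antipode k)).rTensor W *
      (Phi θ.toLinearMap).rTensor W = 1 := by
    rw [← LinearMap.rTensor_mul, i2]; exact LinearMap.rTensor_id _ _
  have d1 := congrArg (LinearMap.det (A := k) (M := (H ⊗[k] V) ⊗[k] W)) i1
  have d3 := congrArg (LinearMap.det (A := k) (M := (H ⊗[k] V) ⊗[k] W)) i3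
  have d4 := congrArg (LinearMap.det (A := k) (M := (H ⊗[k] V) ⊗[k] W)) i4
  simp only [map_mul, map_one] at d1 d3 d4
  have n1 := right_ne_zero_of_mul_eq_one d1
  have n4 := right_ne_zero_of_mul_eq_one d4
  have d2 : LinearMap.det (T b F (rho2 θ.toLinearMap)) = 1 := by
    apply mul_left_cancel₀ (mul_ne_zero n1 n4)
    linear_combination -d3
  rw [← d2, ← det_lT (X := H), ← LinearMap.det_conj (N := (H ⊗[k] V) ⊗[k] W) _ (TensorProduct.assoc k H V W).symm]
  congr 1
  ext x v w
  simp [T, rho2, LinearMap.sum_apply, TensorProduct.tmul_sum]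

end DetAux

/-- Let `H` be a Hopf algebra of finite dimension `d` over `k`, `{hᵢ}` a basis of `H` with dual
basis `{hᵢ*}` of `H* = Hom_k(H,k)` (which carries the convolution product).  For any
finite-dimensional `H`-module `Vp` and `H*`-module `Vm`, the endomorphism
`T : v ⊗ w ↦ ∑ᵢ (hᵢ • v) ⊗ (hᵢ* • w)` of `Vp ⊗ Vm` satisfies `det(T)^d = 1`. -/
theorem det_canonical_action_pow_dim_eq_one {k H : Type*} [Field k] [Ring H] [HopfAlgebra k H]
    [FiniteDimensional k H] {ι : Type*} [Fintype ι] [DecidableEq ι] (b : Module.Basis ι k H)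
    (Vp Vm : Type*)
    [AddCommGroup Vp] [Module k Vp] [Module H Vp]
    [IsScalarTower k H Vp] [SMulCommClass H k Vp] [FiniteDimensional k Vp]
    [AddCommGroup Vm] [Module k Vm] [Module (H →ₗ[k] k) Vm]
    [IsScalarTower k (H →ₗ[k] k) Vm] [SMulCommClass (H →ₗ[k] k) k Vm] [FiniteDimensional k Vm] :
    (LinearMap.det (∑ i : ι, TensorProduct.map
        (DistribMulAction.toLinearMap k Vp (b i))
        (DistribMulAction.toLinearMap k Vm (b.dualBasis i)) :
      Vp ⊗[k] Vm →ₗ[k] Vp ⊗[k] Vm)) ^ (Module.finrank k H) = 1 := by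
  let F : (H →ₗ[k] k) →ₗ[k] Module.End k Vm :=
    { toFun := fun f => DistribMulAction.toLinearMap k Vm f
      map_add' := fun f g => by ext w; exact add_smul f g w
      map_smul' := fun c f => by ext w; exact smul_assoc c f w }
  have h := DetAux.main b F (fun f g => by ext w; exact mul_smul f g w)
    (by ext w; exact one_smul (H →ₗ[k] k) w) (Algebra.lsmul k k Vp : H →ₐ[k] Module.End k Vp)
  rw [← h]
  congr 2
  unfold DetAux.T
  refine Finset.sum_congr rfl fun i _ => ?_
  rw [Module.Basis.coe_dualBasis]
  rfl

end
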